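/- Let A, B ∈ 𝓑 be disjoint and let C ∈ 𝓑 with C ⊆ A be such that u(x; A\C) = 0 for all x ∈ X. Then w(·; A\C, B) is the unique bounded measurable solution f of the Bellman equation f(x) = 1_B(x) + (I_{A\C} f)(x), and for every x ∈ X one has 0 ≤ w(x;A,B) − w(x; A\C, B) ≤ sup_{y∈C} w(y;A,B). -/

import Mathlib

open MeasureTheory ProbabilityTheory

variable {X : Type*} [MeasurableSpace X]

/-- Transition operator: `(Pf)(x) = ∫ f(y) P(x,dy)`. -/
noncomputable def transOp (P : Kernel X X) (f : X → ℝ) : X → ℝ :=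
  fun x => ∫ y, f y ∂(P x)

/-- Invariance operator `I_A f = 1_A · (Pf)`. -/
noncomputable def invOp (P : Kernel X X) (A : Set X) (f : X → ℝ) : X → ℝ :=
  A.indicator (transOp P f)

/-- Invariance value functions `u_n(·;A)`. -/
noncomputable def uN (P : Kernel X X) (A : Set X) : ℕ → X → ℝ
  | 0 => A.indicator 1
  | n + 1 => invOp P A (uN P A n)

/-- `u(x;A) = lim_n u_n(x;A)` (the sequence is pointwise nonincreasing). -/
noncomputable def uFun (P : Kernel X X) (A : Set X) : X → ℝ :=
  fun x => ⨅ n, uN P A n x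

/-- Reach-avoid value functions `w_n(·;A,B)`. -/
noncomputable def wN (P : Kernel X X) (A B : Set X) : ℕ → X → ℝ
  | 0 => B.indicator 1
  | n + 1 => fun x => B.indicator 1 x + invOp P (A \ B) (wN P A B n) x

/-- `w(x;A,B) = lim_n w_n(x;A,B)` (the sequence is pointwise nondecreasing, in `[0,1]`). -/
noncomputable def wFun (P : Kernel X X) (A B : Set X) : X → ℝ :=
  fun x => ⨆ n, wN P A B n x

/-- A bounded function. -/
def BddFun (f : X → ℝ) : Prop := ∃ C : ℝ, ∀ x, |f x| ≤ C

/-- A set `S` is absorbing if `P(x,S) = 1` for all `x ∈ S`. -/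
def Absorbing (P : Kernel X X) (S : Set X) : Prop := ∀ x ∈ S, P x S = 1

/-- A set is simple if its only absorbing measurable subset is empty. -/
def Simple (P : Kernel X X) (A : Set X) : Prop :=
  ∀ S ⊆ A, MeasurableSet S → Absorbing P S → S = ∅


lemma measurable_transOp (P : Kernel X X) [IsMarkovKernel P] {f : X → ℝ} (hf : Measurable f) :
    Measurable (transOp P f) :=
  (hf.stronglyMeasurable.integral_kernel (κ := P)).measurable

lemma measurable_invOp (P : Kernel X X) [IsMarkovKernel P] {A : Set X} (hA : MeasurableSet A)
    {f : X → ℝ} (hf : Measurable f) : Measurable (invOp P A f) :=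
  (measurable_transOp P hf).indicator hA

lemma BddFun.integrable {f : X → ℝ} (hb : BddFun f) (hf : Measurable f) (μ : Measure X)
    [IsFiniteMeasure μ] : Integrable f μ := by
  obtain ⟨K, hK⟩ := hb
  exact Integrable.of_bound hf.aestronglyMeasurable K (ae_of_all _ hK)

lemma bddFun_of_mem_Icc {Y : Type*} {f : Y → ℝ} (h : ∀ x, f x ∈ Set.Icc (0 : ℝ) 1) : BddFun f :=
  ⟨1, fun x => abs_le.2 ⟨by linarith [(h x).1], (h x).2⟩⟩

lemma BddFun.sub {Y : Type*} {f g : Y → ℝ} (hf : BddFun f) (hg : BddFun g) :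
    BddFun (fun x => f x - g x) := by
  obtain ⟨K, hK⟩ := hf
  obtain ⟨L, hL⟩ := hg
  exact ⟨K + L, fun x => (abs_sub _ _).trans (add_le_add (hK x) (hL x))⟩

lemma transOp_mono (P : Kernel X X) [IsMarkovKernel P] {f g : X → ℝ} (hf : Measurable f)
    (hfb : BddFun f) (hg : Measurable g) (hgb : BddFun g) (hfg : ∀ x, f x ≤ g x) (x : X) :
    transOp P f x ≤ transOp P g x :=
  integral_mono (hfb.integrable hf _) (hgb.integrable hg _) hfg

lemma transOp_sub (P : Kernel X X) [IsMarkovKernel P] {f g : X → ℝ} (hf : Measurable f)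
    (hfb : BddFun f) (hg : Measurable g) (hgb : BddFun g) (x : X) :
    transOp P (fun y => f y - g y) x = transOp P f x - transOp P g x :=
  integral_sub (hfb.integrable hf _) (hgb.integrable hg _)

lemma transOp_mem_Icc (P : Kernel X X) [IsMarkovKernel P] {f : X → ℝ} (hf : Measurable f)
    (h : ∀ x, f x ∈ Set.Icc (0 : ℝ) 1) (x : X) : transOp P f x ∈ Set.Icc (0 : ℝ) 1 := by
  refine ⟨integral_nonneg fun y => (h y).1, ?_⟩
  have := integral_mono ((bddFun_of_mem_Icc h).integrable hf (P x)) (integrable_const (1 : ℝ))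
    fun y => (h y).2
  simpa [transOp] using this

lemma measurable_uN (P : Kernel X X) [IsMarkovKernel P] {A : Set X} (hA : MeasurableSet A) :
    ∀ n, Measurable (uN P A n)
  | 0 => measurable_one.indicator hA
  | n + 1 => measurable_invOp P hA (measurable_uN P hA n)

lemma uN_mem_Icc (P : Kernel X X) [IsMarkovKernel P] {A : Set X} (hA : MeasurableSet A) (n : ℕ) :
    ∀ x, uN P A n x ∈ Set.Icc (0 : ℝ) 1 := by
  induction n with
  | zero => intro x; by_cases hx : x ∈ A <;> simp [uN, hx]
  | succ n ih =>
    intro x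
    by_cases hx : x ∈ A
    · simpa [uN, invOp, hx] using transOp_mem_Icc P (measurable_uN P hA n) ih x
    · simp [uN, invOp, hx]

/-- A bounded function that is at most `M` off `A` and subharmonic on `A` is dominated by
`M + K • u_n(·;A)`. -/
lemma le_add_mul_uN (P : Kernel X X) [IsMarkovKernel P] {A : Set X} (hA : MeasurableSet A)
    {g : X → ℝ} (hg : Measurable g) (hgb : BddFun g) {M K : ℝ} (hM : 0 ≤ M)
    (hK : ∀ x, g x ≤ K) (hoff : ∀ x ∉ A, g x ≤ M) (hon : ∀ x ∈ A, g x ≤ transOp P g x)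
    (n : ℕ) : ∀ x, g x ≤ M + K * uN P A n x := by
  induction n with
  | zero =>
    intro x
    by_cases hx : x ∈ A
    · simpa [uN, hx] using (hK x).trans (le_add_of_nonneg_left hM)
    · simpa [uN, hx] using hoff x hx
  | succ n ih =>
    intro x
    by_cases hx : x ∈ A
    · have hi := (bddFun_of_mem_Icc (uN_mem_Icc P hA n)).integrable (measurable_uN P hA n) (P x)
      have h := integral_mono (hgb.integrable hg (P x))
        ((integrable_const M).add (hi.const_mul K)) ih
      have h' : ∫ y, (M + K * uN P A n y) ∂(P x) = M + K * ∫ y, uN P A n y ∂(P x) := by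
        rw [integral_add (integrable_const M) (hi.const_mul K), integral_const_mul]
        simp
      have hle : transOp P g x ≤ M + K * transOp P (uN P A n) x := h.trans_eq h'
      simpa [uN, invOp, hx] using (hon x hx).trans hle
    · simpa [uN, invOp, hx] using hoff x hx

/-- Maximum principle: when `u(·;A) ≡ 0`, a bounded subharmonic function on `A` is controlled by
its values off `A`. -/
lemma le_of_uFun_eq_zero (P : Kernel X X) [IsMarkovKernel P] {A : Set X} (hA : MeasurableSet A)
    (hu : ∀ x, uFun P A x = 0) {g : X → ℝ} (hg : Measurable g) (hgb : BddFun g) {M : ℝ}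
    (hM : 0 ≤ M) (hoff : ∀ x ∉ A, g x ≤ M) (hon : ∀ x ∈ A, g x ≤ transOp P g x) (x : X) :
    g x ≤ M := by
  obtain ⟨K, hK⟩ := hgb
  have hK0 : 0 < K + 1 := by linarith [(abs_nonneg (g x)).trans (hK x)]
  have hn : ∀ n, (g x - M) / (K + 1) ≤ uN P A n x := fun n => by
    rw [div_le_iff₀' hK0]
    linarith [le_add_mul_uN P hA hg ⟨K, hK⟩ hM
      (fun y => ((le_abs_self _).trans (hK y)).trans (le_add_of_nonneg_right zero_le_one))
      hoff hon n x]
  have h : (g x - M) / (K + 1) ≤ 0 := hu x ▸ le_ciInf hn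
  rw [div_le_iff₀ hK0] at h
  linarith

lemma measurable_wN (P : Kernel X X) [IsMarkovKernel P] {A B : Set X} (hA : MeasurableSet A)
    (hB : MeasurableSet B) : ∀ n, Measurable (wN P A B n)
  | 0 => measurable_one.indicator hB
  | n + 1 => (measurable_one.indicator hB).add
      (measurable_invOp P (hA.diff hB) (measurable_wN P hA hB n))

lemma wN_mem_Icc (P : Kernel X X) [IsMarkovKernel P] {A B : Set X} (hA : MeasurableSet A)
    (hB : MeasurableSet B) (n : ℕ) : ∀ x, wN P A B n x ∈ Set.Icc (0 : ℝ) 1 := by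
  induction n with
  | zero => intro x; by_cases hx : x ∈ B <;> simp [wN, hx]
  | succ n ih =>
    intro x
    by_cases hx : x ∈ B
    · simp [wN, invOp, hx]
    · by_cases hx' : x ∈ A
      · simpa [wN, invOp, hx, hx'] using transOp_mem_Icc P (measurable_wN P hA hB n) ih x
      · simp [wN, invOp, hx, hx']

lemma bddFun_wN (P : Kernel X X) [IsMarkovKernel P] {A B : Set X} (hA : MeasurableSet A)
    (hB : MeasurableSet B) (n : ℕ) : BddFun (wN P A B n) :=
  bddFun_of_mem_Icc (wN_mem_Icc P hA hB n)

lemma monotone_wN (P : Kernel X X) [IsMarkovKernel P] {A B : Set X} (hA : MeasurableSet A)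
    (hB : MeasurableSet B) (x : X) : Monotone fun n => wN P A B n x := by
  suffices h : ∀ n x, wN P A B n x ≤ wN P A B (n + 1) x from monotone_nat_of_le_succ (h · x)
  intro n
  induction n with
  | zero =>
    intro x
    exact le_add_of_nonneg_right (Set.indicator_nonneg
      (fun y _ => (transOp_mem_Icc P (measurable_wN P hA hB 0) (wN_mem_Icc P hA hB 0) y).1) x)
  | succ n ih =>
    intro x
    exact add_le_add_right (Set.indicator_le_indicator
      (transOp_mono P (measurable_wN P hA hB n) (bddFun_wN P hA hB n)
        (measurable_wN P hA hB (n + 1)) (bddFun_wN P hA hB (n + 1)) ih x)) _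

lemma wN_mono_set (P : Kernel X X) [IsMarkovKernel P] {D A B : Set X} (hD : MeasurableSet D)
    (hA : MeasurableSet A) (hB : MeasurableSet B) (hDA : D ⊆ A) (n : ℕ) :
    ∀ x, wN P D B n x ≤ wN P A B n x := by
  induction n with
  | zero => exact fun x => le_rfl
  | succ n ih =>
    intro x
    refine add_le_add_right ((Set.indicator_le_indicator
      (transOp_mono P (measurable_wN P hD hB n) (bddFun_wN P hD hB n)
        (measurable_wN P hA hB n) (bddFun_wN P hA hB n) ih x)).trans ?_) _
    exact Set.indicator_le_indicator_of_subset (Set.sdiff_subset_sdiff_left hDA)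
      (fun y => (transOp_mem_Icc P (measurable_wN P hA hB n) (wN_mem_Icc P hA hB n) y).1) x

lemma bddAbove_wN (P : Kernel X X) [IsMarkovKernel P] {A B : Set X} (hA : MeasurableSet A)
    (hB : MeasurableSet B) (x : X) : BddAbove (Set.range fun n => wN P A B n x) :=
  ⟨1, by rintro _ ⟨n, rfl⟩; exact (wN_mem_Icc P hA hB n x).2⟩

lemma tendsto_wN (P : Kernel X X) [IsMarkovKernel P] {A B : Set X} (hA : MeasurableSet A)
    (hB : MeasurableSet B) (x : X) :
    Filter.Tendsto (fun n => wN P A B n x) Filter.atTop (nhds (wFun P A B x)) :=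
  tendsto_atTop_ciSup (monotone_wN P hA hB x) (bddAbove_wN P hA hB x)

lemma measurable_wFun (P : Kernel X X) [IsMarkovKernel P] {A B : Set X} (hA : MeasurableSet A)
    (hB : MeasurableSet B) : Measurable (wFun P A B) :=
  measurable_of_tendsto_metrizable (measurable_wN P hA hB)
    (tendsto_pi_nhds.2 (tendsto_wN P hA hB))

lemma wFun_mem_Icc (P : Kernel X X) [IsMarkovKernel P] {A B : Set X} (hA : MeasurableSet A)
    (hB : MeasurableSet B) (x : X) : wFun P A B x ∈ Set.Icc (0 : ℝ) 1 :=
  isClosed_Icc.mem_of_tendsto (tendsto_wN P hA hB x)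
    (Filter.Eventually.of_forall fun n => wN_mem_Icc P hA hB n x)

lemma bddFun_wFun (P : Kernel X X) [IsMarkovKernel P] {A B : Set X} (hA : MeasurableSet A)
    (hB : MeasurableSet B) : BddFun (wFun P A B) :=
  bddFun_of_mem_Icc (wFun_mem_Icc P hA hB)

/-- The Bellman equation for the reach-avoid value function. -/
lemma wFun_eq (P : Kernel X X) [IsMarkovKernel P] {A B : Set X} (hA : MeasurableSet A)
    (hB : MeasurableSet B) (x : X) :
    wFun P A B x = B.indicator 1 x + invOp P (A \ B) (wFun P A B) x := by
  have hP : Filter.Tendsto (fun n => transOp P (wN P A B n) x) Filter.atTop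
      (nhds (transOp P (wFun P A B) x)) :=
    tendsto_integral_of_dominated_convergence (fun _ => 1)
      (fun n => (measurable_wN P hA hB n).aestronglyMeasurable) (integrable_const 1)
      (fun n => ae_of_all _ fun y =>
        abs_le.2 ⟨by linarith [(wN_mem_Icc P hA hB n y).1], (wN_mem_Icc P hA hB n y).2⟩)
      (ae_of_all _ (tendsto_wN P hA hB))
  refine tendsto_nhds_unique ((Filter.tendsto_add_atTop_iff_nat 1).2 (tendsto_wN P hA hB x)) ?_
  refine Filter.Tendsto.const_add _ ?_
  by_cases hx : x ∈ A \ B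
  · simpa only [invOp, Set.indicator_of_mem hx] using hP
  · simpa only [invOp, Set.indicator_of_notMem hx] using tendsto_const_nhds

/-- Comparison of two bounded solutions of the same affine equation `f = b + I_A f` when
`u(·;A) ≡ 0`; by symmetry they coincide. -/
lemma le_of_bellman (P : Kernel X X) [IsMarkovKernel P] {A : Set X} (hA : MeasurableSet A)
    (hu : ∀ x, uFun P A x = 0) {b f g : X → ℝ} (hf : Measurable f) (hfb : BddFun f)
    (hg : Measurable g) (hgb : BddFun g) (hfe : ∀ x, f x = b x + invOp P A f x)
    (hge : ∀ x, g x = b x + invOp P A g x) (x : X) : f x ≤ g x := by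
  refine sub_nonpos.1 (le_of_uFun_eq_zero P hA hu (hf.sub hg) (hfb.sub hgb) le_rfl ?_ ?_ x)
  · intro y hy
    simp [hfe y, hge y, invOp, hy]
  · intro y hy
    refine le_of_eq ?_
    refine Eq.trans ?_ (transOp_sub P hf hfb hg hgb y).symm
    simp only [Pi.sub_apply]
    rw [hfe y, hge y]
    simp [invOp, hy]

/-- decomposition technique: if `A, B` are disjoint, `C ⊆ A` and
`u(·;A\C) ≡ 0`, then `w(·;A\C,B)` is the unique bounded measurable solution of the Bellman
equation `f = 1_B + I_{A\C} f`, and `0 ≤ w(x;A,B) − w(x;A\C,B) ≤ sup_{y∈C} w(y;A,B)`. -/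
theorem stmt13 (P : Kernel X X) [IsMarkovKernel P] (A B C : Set X)
    (hA : MeasurableSet A) (hB : MeasurableSet B) (hC : MeasurableSet C)
    (hAB : Disjoint A B) (hCA : C ⊆ A)
    (hu : ∀ x, uFun P (A \ C) x = 0) :
    (∀ x, wFun P (A \ C) B x = B.indicator 1 x + invOp P (A \ C) (wFun P (A \ C) B) x) ∧
      (∀ f : X → ℝ, Measurable f → BddFun f →
        (∀ x, f x = B.indicator 1 x + invOp P (A \ C) f x) → f = wFun P (A \ C) B) ∧
      (∀ x, 0 ≤ wFun P A B x - wFun P (A \ C) B x ∧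
        wFun P A B x - wFun P (A \ C) B x ≤ ⨆ y ∈ C, wFun P A B y) := by
  have hD : MeasurableSet (A \ C) := hA.diff hC
  have hDB : (A \ C) \ B = A \ C :=
    (hAB.mono_left Set.sdiff_subset).sdiff_eq_left
  have hAB' : A \ B = A := hAB.sdiff_eq_left
  have hbell := wFun_eq P hD hB
  rw [hDB] at hbell
  have hbellA := wFun_eq P hA hB
  rw [hAB'] at hbellA
  have hm := measurable_wFun P hD hB
  have hmb := bddFun_wFun P hD hB
  have hmA := measurable_wFun P hA hB
  have hmAb := bddFun_wFun P hA hB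
  refine ⟨hbell, fun f hf hfb hfe => funext fun x => le_antisymm
    (le_of_bellman P hD hu hf hfb hm hmb hfe hbell x)
    (le_of_bellman P hD hu hm hmb hf hfb hbell hfe x), fun x => ⟨sub_nonneg.2 ?_, ?_⟩⟩
  · exact ciSup_mono (bddAbove_wN P hA hB x) fun n => wN_mono_set P hD hA hB Set.sdiff_subset n x
  have hM0 : 0 ≤ ⨆ y ∈ C, wFun P A B y :=
    Real.iSup_nonneg fun y => Real.iSup_nonneg fun _ => (wFun_mem_Icc P hA hB y).1
  have hle : ∀ y ∈ C, wFun P A B y ≤ ⨆ y ∈ C, wFun P A B y := fun y hy => by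
    have hbdd : BddAbove (Set.range fun y => ⨆ _ : y ∈ C, wFun P A B y) :=
      ⟨1, by
        rintro _ ⟨z, rfl⟩
        exact Real.iSup_le (fun _ => (wFun_mem_Icc P hA hB z).2) zero_le_one⟩
    simpa [hy] using le_ciSup hbdd y
  refine le_of_uFun_eq_zero P hD hu (hmA.sub hm) (hmAb.sub hmb) hM0 ?_ ?_ x
  · intro y hy
    by_cases hyC : y ∈ C
    · exact (sub_le_self _ (wFun_mem_Icc P hD hB y).1).trans (hle y hyC)
    · have hyA : y ∉ A := fun h => hy ⟨h, hyC⟩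
      simpa [hbell y, hbellA y, invOp, hyA] using hM0
  · intro y hy
    refine le_of_eq (Eq.trans ?_ (transOp_sub P hmA hmAb hm hmb y).symm)
    simp only [Pi.sub_apply]
    rw [hbellA y, hbell y]
    simp [invOp, hy.1, hy.2]
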